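/- If a random vector X in ℝ^d has a log-concave density f, then for all real numbers p > q > 0 with p ≠ 1 and q ≠ 1, h_q(X) − h_p(X) ≤ d·(log q)/(q−1) − d·(log p)/(p−1), with equality when f(x) = e^{−(x_1+⋯+x_d)} on the positive orthant and 0 elsewhere. -/

import Mathlib

open MeasureTheory ProbabilityTheory Real
open scoped ENNReal Classical

noncomputable section

/-- The random vector `X` has density `f` with respect to Lebesgue measure on `ℝ^d`. -/
def HasDensityFn {Ω : Type*} [MeasurableSpace Ω] {d : ℕ}
    (P : Measure Ω) (X : Ω → (Fin d → ℝ)) (f : (Fin d → ℝ) → ℝ) : Prop :=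
  Measurable X ∧ Measurable f ∧ (∀ x, 0 ≤ f x) ∧
    Measure.map X P = volume.withDensity (fun x => ENNReal.ofReal (f x))

/-- Rényi entropy of order `p ∈ (0,1) ∪ (1,∞)` of a density `f` on `ℝ^d`. -/
def renyiEntropy (d : ℕ) (p : ℝ) (f : (Fin d → ℝ) → ℝ) : ℝ :=
  (1 / (1 - p)) * Real.log (∫ x, f x ^ p)

/-- A nonnegative function on a real vector space is log-concave:
`f(αx + (1-α)y) ≥ f(x)^α f(y)^(1-α)`. -/
def IsLogConcaveFn {E : Type*} [AddCommGroup E] [Module ℝ E] (f : E → ℝ) : Prop :=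
  (∀ x, 0 ≤ f x) ∧ ∀ x y : E, ∀ α : ℝ, 0 ≤ α → α ≤ 1 →
    f x ^ α * f y ^ (1 - α) ≤ f (α • x + (1 - α) • y)

/-- The standard multidimensional exponential density `e^{-(x₁+⋯+x_d)}` on the
positive orthant, `0` elsewhere. -/
def expOrthantDensity (d : ℕ) : (Fin d → ℝ) → ℝ :=
  fun x => if ∀ i, 0 < x i then Real.exp (-(∑ i, x i)) else 0

open scoped Pointwise in
lemma pl_compact {a b : ℝ} (ha : 0 < a) (hb : 0 < b) {K L C : Set ℝ}
    (hK : IsCompact K) (hL : IsCompact L) (hKn : K.Nonempty) (hLn : L.Nonempty)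
    (h : ∀ x ∈ K, ∀ y ∈ L, a * x + b * y ∈ C) :
    ENNReal.ofReal a * volume K + ENNReal.ofReal b * volume L ≤ volume C := by
  obtain ⟨k, hk, hkmax⟩ := hK.exists_isGreatest hKn
  obtain ⟨l, hl, hlmin⟩ := hL.exists_isLeast hLn
  have e1 : ∀ (r c : ℝ) (_ : 0 < r) (S : Set ℝ),
      volume ((fun x => c + r * x) '' S) = ENNReal.ofReal r * volume S := by
    intro r c hr S
    have : (fun x => c + r * x) '' S = (fun x => c + x) '' (r • S) := by
      ext z
      simp only [Set.mem_image, Set.mem_smul_set, smul_eq_mul]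
      constructor
      · rintro ⟨x, hx, rfl⟩
        exact ⟨_, ⟨x, hx, rfl⟩, rfl⟩
      · rintro ⟨_, ⟨x, hx, rfl⟩, rfl⟩
        exact ⟨x, hx, rfl⟩
    rw [this, Set.image_add_left, measure_preimage_add, Measure.addHaar_smul]
    simp [abs_of_pos hr]
  have c1 : IsCompact ((fun x => b * l + a * x) '' K) := hK.image (by fun_prop)
  have c2 : IsCompact ((fun x => a * k + b * x) '' L) := hL.image (by fun_prop)
  have hd : AEDisjoint volume ((fun x => b * l + a * x) '' K) ((fun x => a * k + b * x) '' L) := by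
    have : ((fun x => b * l + a * x) '' K) ∩ ((fun x => a * k + b * x) '' L) ⊆ {a * k + b * l} := by
      rintro z ⟨⟨x, hx, rfl⟩, ⟨y, hy, hxy⟩⟩
      have h1 := hkmax hx
      have h2 := hlmin hy
      simp only [Set.mem_singleton_iff] at *
      nlinarith
    exact measure_mono_null this (by simp)
  rw [← e1 a (b * l) ha K, ← e1 b (a * k) hb L,
    ← measure_union₀ c2.measurableSet.nullMeasurableSet hd]
  apply measure_mono
  rintro z (⟨x, hx, rfl⟩ | ⟨y, hy, rfl⟩)
  · simpa [add_comm] using h x hx l hl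
  · exact h k hk y hy

lemma pl_reg {r c m : ℝ≥0∞} (hr : r ≠ 0) (hr' : r ≠ ∞) {A : Set ℝ} (hA : MeasurableSet A)
    (hAn : A.Nonempty)
    (h : ∀ K ⊆ A, IsCompact K → K.Nonempty → r * volume K + c ≤ m) :
    r * volume A + c ≤ m := by
  obtain ⟨a, ha⟩ := hAn
  have h0 := h {a} (by simpa using ha) isCompact_singleton (by simp)
  by_cases hc : c = ∞
  · subst hc; simpa using h0
  have key : volume A ≤ (m - c) / r := by
    apply le_of_forall_lt
    intro s hs
    obtain ⟨K, hKA, hK, hsK⟩ := hA.exists_lt_isCompact hs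
    have hKn : K.Nonempty := by
      rw [Set.nonempty_iff_ne_empty]; rintro rfl; simp at hsK
    refine hsK.trans_le ?_
    rw [ENNReal.le_div_iff_mul_le (Or.inl hr) (Or.inl hr'), mul_comm]
    exact ENNReal.le_sub_of_add_le_right hc (h K hKA hK hKn)
  rw [ENNReal.le_div_iff_mul_le (Or.inl hr) (Or.inl hr'), mul_comm] at key
  calc r * volume A + c ≤ (m - c) + c := by gcongr
    _ = m := tsub_add_cancel_of_le (le_trans (by simp) h0)

lemma pl_sets {a b : ℝ} (ha : 0 < a) (hb : 0 < b) {A B C : Set ℝ}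
    (hA : MeasurableSet A) (hB : MeasurableSet B) (hAn : A.Nonempty) (hBn : B.Nonempty)
    (h : ∀ x ∈ A, ∀ y ∈ B, a * x + b * y ∈ C) :
    ENNReal.ofReal a * volume A + ENNReal.ofReal b * volume B ≤ volume C := by
  apply pl_reg (by simpa using ha) (by simp) hA hAn
  intro K hKA hK hKn
  rw [add_comm]
  apply pl_reg (by simpa using hb) (by simp) hB hBn
  intro L hLB hL hLn
  rw [add_comm]
  exact pl_compact ha hb hK hL hKn hLn fun x hx y hy => h x (hKA hx) y (hLB hy)

lemma amgm_ennreal {a b : ℝ} (ha : 0 < a) (hb : 0 < b) (hab : a + b = 1) (x y : ℝ≥0∞) :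
    x ^ a * y ^ b ≤ ENNReal.ofReal a * x + ENNReal.ofReal b * y := by
  have ha' : ENNReal.ofReal a ≠ 0 := by simpa using ha
  have hb' : ENNReal.ofReal b ≠ 0 := by simpa using hb
  rcases eq_or_ne x ∞ with rfl | hx
  · simp [ENNReal.mul_top ha']
  rcases eq_or_ne y ∞ with rfl | hy
  · simp [ENNReal.mul_top hb']
  lift x to NNReal using hx
  lift y to NNReal using hy
  have := NNReal.geom_mean_le_arith_mean2_weighted a.toNNReal b.toNNReal x y
    (by rw [← Real.toNNReal_add ha.le hb.le, hab]; simp)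
  rw [Real.coe_toNNReal _ ha.le, Real.coe_toNNReal _ hb.le] at this
  rw [← ENNReal.coe_rpow_of_nonneg _ ha.le, ← ENNReal.coe_rpow_of_nonneg _ hb.le]
  unfold ENNReal.ofReal
  exact_mod_cast this

lemma pl_norm {a b : ℝ} (ha : 0 < a) (hb : 0 < b) (hab : a + b = 1) {u v w : ℝ → ℝ}
    (hu : Measurable u) (hv : Measurable v) (hw : Measurable w)
    (hu0 : ∀ x, 0 ≤ u x) (hv0 : ∀ x, 0 ≤ v x) (hw0 : ∀ x, 0 ≤ w x)
    (hu1 : ∀ x, u x ≤ 1) (hv1 : ∀ x, v x ≤ 1)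
    (hus : ∀ t < 1, ∃ x, t < u x) (hvs : ∀ t < 1, ∃ x, t < v x)
    (h : ∀ x y, u x ^ a * v y ^ b ≤ w (a * x + b * y)) :
    (∫⁻ x, ENNReal.ofReal (u x)) ^ a * (∫⁻ x, ENNReal.ofReal (v x)) ^ b
      ≤ ∫⁻ x, ENNReal.ofReal (w x) := by
  refine (amgm_ennreal ha hb hab _ _).trans ?_
  rw [lintegral_eq_lintegral_meas_lt volume (.of_forall hu0) hu.aemeasurable,
    lintegral_eq_lintegral_meas_lt volume (.of_forall hv0) hv.aemeasurable,
    lintegral_eq_lintegral_meas_lt volume (.of_forall hw0) hw.aemeasurable]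
  have anti : ∀ g : ℝ → ℝ, Measurable fun t : ℝ => volume {x | t < g x} := by
    intro g
    apply Antitone.measurable
    intro s t hst
    exact measure_mono fun x (hx : t < g x) => lt_of_le_of_lt hst hx
  rw [← lintegral_const_mul _ (anti u), ← lintegral_const_mul _ (anti v),
    ← lintegral_add_left ((anti u).const_mul _)]
  apply setLIntegral_mono (anti w)
  intro t ht
  have ht : 0 < t := ht
  rcases lt_or_ge t 1 with h1 | h1
  · apply pl_sets ha hb (measurableSet_lt measurable_const hu)
      (measurableSet_lt measurable_const hv) (hus t h1) (hvs t h1)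
    intro x hx y hy
    have hx : t < u x := hx
    have hy : t < v y := hy
    refine lt_of_lt_of_le ?_ (h x y)
    calc t = t ^ a * t ^ b := by rw [← Real.rpow_add ht, hab, Real.rpow_one]
      _ < u x ^ a * v y ^ b := by
        apply mul_lt_mul'' (Real.rpow_lt_rpow ht.le hx ha) (Real.rpow_lt_rpow ht.le hy hb)
          <;> positivity
  · have e1 : {x | t < u x} = ∅ := by
      ext x; simpa using (hu1 x).trans h1
    have e2 : {x | t < v x} = ∅ := by
      ext x; simpa using (hv1 x).trans h1
    simp [e1, e2]

lemma pl_bdd {a b : ℝ} (ha : 0 < a) (hb : 0 < b) (hab : a + b = 1) {u v w : ℝ → ℝ}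
    (hu : Measurable u) (hv : Measurable v) (hw : Measurable w)
    (hu0 : ∀ x, 0 ≤ u x) (hv0 : ∀ x, 0 ≤ v x) (hw0 : ∀ x, 0 ≤ w x)
    (hu1 : BddAbove (Set.range u)) (hv1 : BddAbove (Set.range v))
    (h : ∀ x y, u x ^ a * v y ^ b ≤ w (a * x + b * y)) :
    (∫⁻ x, ENNReal.ofReal (u x)) ^ a * (∫⁻ x, ENNReal.ofReal (v x)) ^ b
      ≤ ∫⁻ x, ENNReal.ofReal (w x) := by
  set M := ⨆ x, u x with hM
  set N := ⨆ x, v x with hN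
  have huM : ∀ x, u x ≤ M := fun x => le_ciSup hu1 x
  have hvN : ∀ x, v x ≤ N := fun x => le_ciSup hv1 x
  rcases eq_or_lt_of_le ((hu0 0).trans (huM 0)) with hM0 | hM0
  · have : ∀ x, u x = 0 := fun x => le_antisymm (by rw [hM0]; exact huM x) (hu0 x)
    simp [this, ENNReal.zero_rpow_of_pos ha]
  rcases eq_or_lt_of_le ((hv0 0).trans (hvN 0)) with hN0 | hN0
  · have : ∀ x, v x = 0 := fun x => le_antisymm (by rw [hN0]; exact hvN x) (hv0 x)
    simp [this, ENNReal.zero_rpow_of_pos hb]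
  have hKpos : 0 < M ^ a * N ^ b := by positivity
  have key := pl_norm ha hb hab (u := fun x => u x / M) (v := fun x => v x / N)
    (w := fun x => w x / (M ^ a * N ^ b)) (hu.div_const _) (hv.div_const _) (hw.div_const _)
    (fun x => div_nonneg (hu0 x) hM0.le) (fun x => div_nonneg (hv0 x) hN0.le)
    (fun x => div_nonneg (hw0 x) hKpos.le)
    (fun x => (div_le_one hM0).2 (huM x)) (fun x => (div_le_one hN0).2 (hvN x))
    (fun t ht => by
      obtain ⟨x, hx⟩ := exists_lt_of_lt_ciSup (show t * M < ⨆ x, u x by rw [← hM]; nlinarith)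
      exact ⟨x, (lt_div_iff₀ hM0).2 hx⟩)
    (fun t ht => by
      obtain ⟨x, hx⟩ := exists_lt_of_lt_ciSup (show t * N < ⨆ x, v x by rw [← hN]; nlinarith)
      exact ⟨x, (lt_div_iff₀ hN0).2 hx⟩)
    (fun x y => by
      rw [Real.div_rpow (hu0 x) hM0.le, Real.div_rpow (hv0 y) hN0.le, div_mul_div_comm]
      gcongr
      exact h x y)
  have sc : ∀ (g : ℝ → ℝ) (c : ℝ) (_ : 0 < c) (_ : Measurable g),
      ∫⁻ x, ENNReal.ofReal (g x) = ENNReal.ofReal c * ∫⁻ x, ENNReal.ofReal (g x / c) := by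
    intro g c hc hg
    rw [← lintegral_const_mul _ (hg.div_const c).ennreal_ofReal]
    congr 1; ext x
    rw [← ENNReal.ofReal_mul hc.le]
    congr 1; field_simp
  rw [sc u M hM0 hu, sc v N hN0 hv, sc w _ hKpos hw, ENNReal.mul_rpow_of_nonneg _ _ ha.le,
    ENNReal.mul_rpow_of_nonneg _ _ hb.le, mul_mul_mul_comm, ENNReal.ofReal_rpow_of_pos hM0,
    ENNReal.ofReal_rpow_of_pos hN0, ← ENNReal.ofReal_mul (by positivity)]
  gcongr

lemma pl_one {a b : ℝ} (ha : 0 < a) (hb : 0 < b) (hab : a + b = 1) {u v w : ℝ → ℝ≥0∞}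
    (hu : Measurable u) (hv : Measurable v) (hw : Measurable w)
    (h : ∀ x y, u x ^ a * v y ^ b ≤ w (a * x + b * y)) :
    (∫⁻ x, u x) ^ a * (∫⁻ x, v x) ^ b ≤ ∫⁻ x, w x := by
  have step : ∀ n : ℕ, (∫⁻ x, min (u x) n) ^ a * (∫⁻ x, min (v x) n) ^ b ≤ ∫⁻ x, w x := by
    intro n
    have fin : ∀ z : ℝ≥0∞, min z n ≠ ∞ := fun z =>
      ne_top_of_le_ne_top (ENNReal.natCast_ne_top n) (min_le_right _ _)
    have hb1 : ∀ g : ℝ → ℝ≥0∞, BddAbove (Set.range fun x => (min (g x) n).toReal) := by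
      intro g
      refine ⟨n, ?_⟩
      rintro _ ⟨x, rfl⟩
      have := ENNReal.toReal_mono (ENNReal.natCast_ne_top n) (min_le_right (g x) n)
      simpa using this
    have := pl_bdd ha hb hab (u := fun x => (min (u x) n).toReal)
      (v := fun x => (min (v x) n).toReal) (w := fun x => (min (w x) n).toReal)
      (hu.min measurable_const).ennreal_toReal (hv.min measurable_const).ennreal_toReal
      (hw.min measurable_const).ennreal_toReal (fun _ => ENNReal.toReal_nonneg)
      (fun _ => ENNReal.toReal_nonneg) (fun _ => ENNReal.toReal_nonneg) (hb1 u) (hb1 v)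
      (fun x y => by
        rw [ENNReal.toReal_rpow, ENNReal.toReal_rpow, ← ENNReal.toReal_mul]
        apply ENNReal.toReal_mono (fin _)
        refine le_min (le_trans ?_ (h x y)) ?_
        · gcongr <;> exact min_le_left _ _
        · calc _ ≤ (n : ℝ≥0∞) ^ a * (n : ℝ≥0∞) ^ b := by gcongr <;> exact min_le_right _ _
            _ = n := by
              rw [← ENNReal.rpow_add_of_nonneg _ _ ha.le hb.le, hab, ENNReal.rpow_one])
    simp only [ENNReal.ofReal_toReal (fin _)] at this
    exact this.trans (lintegral_mono fun x => min_le_left _ _)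
  have lim : ∀ g : ℝ → ℝ≥0∞, Measurable g → ∫⁻ x, g x = ⨆ n : ℕ, ∫⁻ x, min (g x) n := by
    intro g hg
    rw [← lintegral_iSup (fun n => hg.min measurable_const)
      (fun m n hmn x => by dsimp only; gcongr)]
    congr 1; ext x
    rw [← inf_iSup_eq, ENNReal.iSup_natCast, inf_top_eq]
  have pw : ∀ (c : ℝ) (_ : 0 < c) (s : ℕ → ℝ≥0∞), (⨆ n, s n) ^ c = ⨆ n, (s n) ^ c := by
    intro c hc s
    exact (ENNReal.orderIsoRpow c hc).map_iSup s
  rw [lim u hu, lim v hv, pw a ha, pw b hb, ENNReal.iSup_mul]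
  refine iSup_le fun m => ?_
  rw [ENNReal.mul_iSup]
  refine iSup_le fun n => ?_
  refine le_trans ?_ (step (max m n))
  gcongr
  · exact le_max_left _ _
  · exact le_max_right _ _

lemma pl_dim {a b : ℝ} (ha : 0 < a) (hb : 0 < b) (hab : a + b = 1) (d : ℕ) :
    ∀ {u v w : (Fin d → ℝ) → ℝ≥0∞}
    (_ : Measurable u) (_ : Measurable v) (_ : Measurable w)
    (_ : ∀ x y, u x ^ a * v y ^ b ≤ w (a • x + b • y)),
    (∫⁻ x, u x) ^ a * (∫⁻ x, v x) ^ b ≤ ∫⁻ x, w x := by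
  induction d with
  | zero =>
    intro u v w hu hv hw h
    simp only [lintegral_unique]
    have := h default default
    rw [Subsingleton.elim (a • default + b • default : Fin 0 → ℝ) default] at this
    have h1 : volume (Set.univ : Set (Fin 0 → ℝ)) = 1 := by
      simp [volume_pi]
    rw [h1, mul_one, mul_one, mul_one]
    convert this using 3 <;> exact congrArg _ (Subsingleton.elim _ _)
  | succ d ih =>
    intro u v w hu hv hw h
    let e := (MeasurableEquiv.piFinSuccAbove (fun _ : Fin (d + 1) => ℝ) 0).symm
    have he : MeasurePreserving e volume volume :=
      (volume_preserving_piFinSuccAbove (fun _ : Fin (d + 1) => ℝ) 0).symm _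
    have fub : ∀ g : (Fin (d + 1) → ℝ) → ℝ≥0∞, Measurable g →
        ∫⁻ x, g x = ∫⁻ s : ℝ, ∫⁻ y : Fin d → ℝ, g (e (s, y)) := by
      intro g hg
      rw [← he.lintegral_comp hg, Measure.volume_eq_prod]
      exact lintegral_prod (g ∘ e) (hg.comp e.measurable).aemeasurable
    have elin : ∀ (s t : ℝ) (x y : Fin d → ℝ),
        a • e (s, x) + b • e (t, y) = e (a * s + b * t, a • x + b • y) := by
      intro s t x y
      ext i
      refine Fin.cases ?_ (fun j => ?_) i <;> simp [e, MeasurableEquiv.piFinSuccAbove]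
    rw [fub u hu, fub v hv, fub w hw]
    have hm : ∀ g : (Fin (d + 1) → ℝ) → ℝ≥0∞, Measurable g →
        Measurable fun s : ℝ => ∫⁻ y : Fin d → ℝ, g (e (s, y)) := by
      intro g hg
      exact (hg.comp e.measurable).lintegral_prod_right'
    apply pl_one ha hb hab (hm u hu) (hm v hv) (hm w hw)
    intro s t
    have ms : ∀ (g : (Fin (d + 1) → ℝ) → ℝ≥0∞) (s : ℝ), Measurable g →
        Measurable fun y : Fin d → ℝ => g (e (s, y)) := fun g s hg =>
      (hg.comp e.measurable).comp measurable_prodMk_left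
    apply ih (ms u s hu) (ms v t hv) (ms w _ hw)
    intro x y
    rw [← elin]
    exact h _ _

/-- `t^d ∫ f^t`, as an extended nonnegative real. -/
def plG (d : ℕ) (f : (Fin d → ℝ) → ℝ) (t : ℝ) : ℝ≥0∞ :=
  ENNReal.ofReal (t ^ d) * ∫⁻ x, ENNReal.ofReal (f x ^ t)

lemma plG_eq {d : ℕ} {f : (Fin d → ℝ) → ℝ} (hf : Measurable f) {t : ℝ} (ht : 0 < t) :
    plG d f t = ∫⁻ y, ENNReal.ofReal (f (t⁻¹ • y) ^ t) := by
  have hm : Measurable fun x => ENNReal.ofReal (f x ^ t) := (hf.pow_const t).ennreal_ofReal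
  have h := Measure.map_addHaar_smul (volume : Measure (Fin d → ℝ)) (inv_ne_zero ht.ne')
  have h2 : ∫⁻ y, ENNReal.ofReal (f (t⁻¹ • y) ^ t)
      = ∫⁻ x, ENNReal.ofReal (f x ^ t) ∂(Measure.map (fun x : Fin d → ℝ => t⁻¹ • x) volume) :=
    (lintegral_map hm (measurable_const_smul _)).symm
  rw [h2, h, lintegral_smul_measure, plG]
  simp [abs_of_pos ht]

lemma plG_logconcave {d : ℕ} {f : (Fin d → ℝ) → ℝ} (hfm : Measurable f) (hf : IsLogConcaveFn f)
    {s t a b : ℝ} (hs : 0 < s) (ht : 0 < t) (ha : 0 < a) (hb : 0 < b) (hab : a + b = 1) :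
    plG d f s ^ a * plG d f t ^ b ≤ plG d f (a * s + b * t) := by
  have hr : 0 < a * s + b * t := by positivity
  set r := a * s + b * t with hrdef
  rw [plG_eq hfm hs, plG_eq hfm ht, plG_eq hfm hr]
  have hm : ∀ t : ℝ, Measurable fun y => ENNReal.ofReal (f (t⁻¹ • y) ^ t) := fun t =>
    ((hfm.comp (measurable_const_smul _)).pow_const t).ennreal_ofReal
  apply pl_dim ha hb hab d (hm s) (hm t) (hm r)
  intro x y
  rw [ENNReal.ofReal_rpow_of_nonneg (Real.rpow_nonneg (hf.1 _) _) ha.le,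
    ENNReal.ofReal_rpow_of_nonneg (Real.rpow_nonneg (hf.1 _) _) hb.le,
    ← ENNReal.ofReal_mul (Real.rpow_nonneg (Real.rpow_nonneg (hf.1 _) _) _)]
  apply ENNReal.ofReal_le_ofReal
  have e1 : 1 - a * s / r = b * t / r := by rw [hrdef]; field_simp; ring
  have h := hf.2 (s⁻¹ • x) (t⁻¹ • y) (a * s / r) (by positivity)
    (by rw [div_le_one hr, hrdef]; nlinarith [mul_pos hb ht])
  rw [e1] at h
  have e2 : (a * s / r) • s⁻¹ • x + (b * t / r) • t⁻¹ • y = r⁻¹ • (a • x + b • y) := by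
    rw [smul_add, smul_smul, smul_smul, smul_smul, smul_smul]
    congr 2 <;> field_simp
  rw [e2] at h
  have h' := Real.rpow_le_rpow (mul_nonneg (Real.rpow_nonneg (hf.1 _) _)
    (Real.rpow_nonneg (hf.1 _) _)) h hr.le
  refine le_of_eq_of_le ?_ h'
  rw [Real.mul_rpow (Real.rpow_nonneg (hf.1 _) _) (Real.rpow_nonneg (hf.1 _) _),
    ← Real.rpow_mul (hf.1 _), ← Real.rpow_mul (hf.1 _), ← Real.rpow_mul (hf.1 _),
    ← Real.rpow_mul (hf.1 _)]
  congr 2 <;> field_simp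

lemma plG_pos {d : ℕ} {f : (Fin d → ℝ) → ℝ} (hfm : Measurable f) (hf0 : ∀ x, 0 ≤ f x)
    (h1 : plG d f 1 = 1) {t : ℝ} (ht : 0 < t) : plG d f t ≠ 0 := by
  intro h0
  have h2 : ∫⁻ x, ENNReal.ofReal (f x ^ t) = 0 := by
    rcases mul_eq_zero.1 h0 with h | h
    · have : 0 < t ^ d := by positivity
      simp at h; linarith
    · exact h
  rw [lintegral_eq_zero_iff (hfm.pow_const t).ennreal_ofReal] at h2
  have h3 : ∫⁻ x, ENNReal.ofReal (f x ^ (1:ℝ)) = 0 := by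
    rw [lintegral_eq_zero_iff (hfm.pow_const _).ennreal_ofReal]
    filter_upwards [h2] with x hx
    simp only [Pi.zero_apply, ENNReal.ofReal_eq_zero] at hx ⊢
    have : f x = 0 := by
      by_contra hne
      have : 0 < f x := lt_of_le_of_ne (hf0 x) (Ne.symm hne)
      have := Real.rpow_pos_of_pos this t
      linarith
    simp [this]
  rw [plG, h3, mul_zero] at h1
  exact zero_ne_one h1

lemma plG_fin {d : ℕ} {f : (Fin d → ℝ) → ℝ} (hfm : Measurable f) (hf : IsLogConcaveFn f)
    (h1 : plG d f 1 = 1) {t : ℝ} (ht : 0 < t) : plG d f t ≠ ∞ := by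
  intro htop
  -- choose a small with `(1 - a t)/(1 - a) > 0`
  have ha : 0 < 1 / (2 + t) := by positivity
  have ha1 : 1 / (2 + t) < 1 := by rw [div_lt_one (by positivity)]; linarith
  set a := 1 / (2 + t) with hadef
  have hat : a * t < 1 := by rw [hadef]; field_simp; linarith
  have hs : 0 < (1 - a * t) / (1 - a) := div_pos (by linarith) (by linarith)
  have key := plG_logconcave hfm hf ht hs ha (sub_pos.2 ha1) (by ring)
  have e : a * t + (1 - a) * ((1 - a * t) / (1 - a)) = 1 := by
    rw [mul_div_cancel₀ _ (sub_pos.2 ha1).ne']; ring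
  rw [e, h1, htop, ENNReal.top_rpow_of_pos ha, ENNReal.top_mul] at key
  · simp at key
  · intro h
    rcases ENNReal.rpow_eq_zero_iff.1 h with h | h
    · exact plG_pos hfm hf.1 h1 hs h.1
    · linarith [h.2]

lemma plG_concave {d : ℕ} {f : (Fin d → ℝ) → ℝ} (hfm : Measurable f) (hf : IsLogConcaveFn f)
    (h1 : plG d f 1 = 1) :
    ConcaveOn ℝ (Set.Ioi 0) fun t => Real.log (plG d f t).toReal := by
  rw [concaveOn_iff_forall_pos]
  refine ⟨convex_Ioi 0, ?_⟩
  intro s hs t ht a b ha hb hab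
  have hs : 0 < s := hs
  have ht : 0 < t := ht
  have hr : 0 < a * s + b * t := by positivity
  have pos : ∀ r, 0 < r → 0 < (plG d f r).toReal := fun r hr =>
    ENNReal.toReal_pos (plG_pos hfm hf.1 h1 hr) (plG_fin hfm hf h1 hr)
  have key := ENNReal.toReal_mono (plG_fin hfm hf h1 hr) (plG_logconcave hfm hf hs ht ha hb hab)
  rw [ENNReal.toReal_mul, ← ENNReal.toReal_rpow, ← ENNReal.toReal_rpow] at key
  have p1 := pos s hs
  have p2 := pos t ht
  have := Real.log_le_log (by positivity) key
  rw [Real.log_mul (by positivity) (by positivity), Real.log_rpow p1, Real.log_rpow p2] at this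
  simpa using this

lemma renyi_eq {d : ℕ} {f : (Fin d → ℝ) → ℝ} (hfm : Measurable f) (hf : IsLogConcaveFn f)
    (h1 : plG d f 1 = 1) {t : ℝ} (ht : 0 < t) (ht1 : t ≠ 1) :
    renyiEntropy d t f = d * (Real.log t / (t - 1)) - Real.log (plG d f t).toReal / (t - 1) := by
  have hi : (∫ x, f x ^ t) = (∫⁻ x, ENNReal.ofReal (f x ^ t)).toReal :=
    integral_eq_lintegral_of_nonneg_ae (.of_forall fun x => Real.rpow_nonneg (hf.1 x) t)
      (hfm.pow_const t).aestronglyMeasurable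
  have hG : (plG d f t).toReal = t ^ d * ∫ x, f x ^ t := by
    rw [plG, ENNReal.toReal_mul, ENNReal.toReal_ofReal (by positivity), hi]
  have hGpos : 0 < (plG d f t).toReal :=
    ENNReal.toReal_pos (plG_pos hfm hf.1 h1 ht) (plG_fin hfm hf h1 ht)
  have hne : (∫ x, f x ^ t) ≠ 0 := by
    intro h; rw [hG, h, mul_zero] at hGpos; exact lt_irrefl _ hGpos
  have h1t : 1 - t ≠ 0 := sub_ne_zero.2 ht1.symm
  have ht1' : t - 1 ≠ 0 := sub_ne_zero.2 ht1
  rw [hG, Real.log_mul (by positivity) hne, Real.log_pow, renyiEntropy]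
  field_simp
  ring

lemma renyi_exp (d : ℕ) {t : ℝ} (ht : 0 < t) (ht1 : t ≠ 1) :
    renyiEntropy d t (expOrthantDensity d) = d * (Real.log t / (t - 1)) := by
  have h : ∀ x, expOrthantDensity d x ^ t
      = ∏ i, (Set.Ioi (0:ℝ)).indicator (fun s => Real.exp ((-t) * s)) (x i) := by
    intro x
    unfold expOrthantDensity
    split_ifs with hx
    · rw [← Real.exp_mul, ← Finset.sum_neg_distrib, Finset.sum_mul, Real.exp_sum]
      refine Finset.prod_congr rfl fun i _ => ?_
      rw [Set.indicator_of_mem (Set.mem_Ioi.2 (hx i))]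
      congr 1; ring
    · push Not at hx
      obtain ⟨i, hi⟩ := hx
      rw [Real.zero_rpow ht.ne', Finset.prod_eq_zero (Finset.mem_univ i)]
      exact Set.indicator_of_notMem (by simpa using hi) _
  have h2 : ∫ x, expOrthantDensity d x ^ t = (1 / t) ^ d := by
    simp_rw [h]
    rw [integral_fintype_prod_volume_eq_pow, integral_indicator measurableSet_Ioi,
      integral_exp_mul_Ioi (by linarith)]
    simp
  have h1t : 1 - t ≠ 0 := sub_ne_zero.2 ht1.symm
  have ht1' : t - 1 ≠ 0 := sub_ne_zero.2 ht1
  rw [renyiEntropy, h2, Real.log_pow, one_div, one_div, Real.log_inv]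
  field_simp
  ring

/-- If a random vector `X` in `ℝ^d` has a log-concave density `f`, then for `p > q > 0`
with `p ≠ 1 ≠ q`, `h_q(X) - h_p(X) ≤ d log q/(q-1) - d log p/(p-1)`, with equality for
the exponential density on the positive orthant. -/
theorem renyi_entropy_comparison_logconcave {Ω : Type*} [MeasurableSpace Ω] {d : ℕ}
    (hd : 0 < d) (P : Measure Ω) [IsProbabilityMeasure P]
    (X : Ω → (Fin d → ℝ)) (f : (Fin d → ℝ) → ℝ)
    (hX : HasDensityFn P X f) (hf : IsLogConcaveFn f)
    (p q : ℝ) (hq0 : 0 < q) (hqp : q < p) (hp1 : p ≠ 1) (hq1 : q ≠ 1) :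
    renyiEntropy d q f - renyiEntropy d p f
      ≤ d * (Real.log q / (q - 1)) - d * (Real.log p / (p - 1)) ∧
    renyiEntropy d q (expOrthantDensity d) - renyiEntropy d p (expOrthantDensity d)
      = d * (Real.log q / (q - 1)) - d * (Real.log p / (p - 1)) := by
  obtain ⟨_, hfm, hf0, hmap⟩ := hX
  have hp0 : 0 < p := hq0.trans hqp
  refine ⟨?_, by rw [renyi_exp d hq0 hq1, renyi_exp d hp0 hp1]⟩
  have h1 : plG d f 1 = 1 := by
    have hu : Measure.map X P Set.univ = 1 := by
      rw [Measure.map_apply ‹_› MeasurableSet.univ]; simp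
    rw [hmap, withDensity_apply _ MeasurableSet.univ, Measure.restrict_univ] at hu
    simp [plG, hu]
  rw [renyi_eq hfm hf h1 hq0 hq1, renyi_eq hfm hf h1 hp0 hp1]
  have hs := (plG_concave hfm hf h1).slope_anti (x := 1) (by simp)
    (show q ∈ Set.Ioi (0:ℝ) \ {1} from ⟨hq0, hq1⟩) (show p ∈ Set.Ioi (0:ℝ) \ {1} from ⟨hp0, hp1⟩)
    hqp.le
  simp only [slope_def_field, h1, ENNReal.toReal_one, Real.log_one, sub_zero] at hs
  linarith
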